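/- Let (a,b,c) be a positive primitive solution to a² + b² = 2c² and n a square-free integer. Then the elliptic curve E⁽ⁿ⁾: y² = x(x - a²n)(x + b²n) has torsion subgroup over ℚ isomorphic to (ℤ/2ℤ)². -/

import Mathlib

/-- The quadratic twist curve `y² = x(x - a²n)(x + b²n)` as a Weierstrass curve over `ℚ`. -/
def twistCurve (a b n : ℤ) : WeierstrassCurve.Affine ℚ :=
  { a₁ := 0
    a₂ := (b : ℚ) ^ 2 * (n : ℚ) - (a : ℚ) ^ 2 * (n : ℚ)
    a₃ := 0
    a₄ := -((a : ℚ) ^ 2 * (b : ℚ) ^ 2 * (n : ℚ) ^ 2)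
    a₆ := 0 }


open WeierstrassCurve.Affine in
theorem twistCurve_equation {a b n : ℤ} {x y : ℚ} :
    (twistCurve a b n).Equation x y ↔
      y ^ 2 = x ^ 3 + (b ^ 2 * n - a ^ 2 * n) * x ^ 2 - a ^ 2 * b ^ 2 * n ^ 2 * x := by
  rw [equation_iff]
  simp only [twistCurve]
  constructor <;> intro h <;> linear_combination h

theorem twistCurve_negY (a b n : ℤ) (x y : ℚ) : (twistCurve a b n).negY x y = -y := by
  simp [WeierstrassCurve.Affine.negY, twistCurve]

open WeierstrassCurve.Affine in
theorem twistCurve_two_nsmul_eq_zero_iff {a b n : ℤ} {x y : ℚ}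
    (h : (twistCurve a b n).Nonsingular x y) : 2 • Point.some x y h = 0 ↔ y = 0 := by
  rw [two_nsmul, add_eq_zero_iff_eq_neg, Point.neg_some, Point.some.injEq, twistCurve_negY]
  constructor
  · rintro ⟨-, hy⟩
    linarith
  · rintro rfl
    simp

open WeierstrassCurve.Affine in
theorem twistCurve_exists_two_nsmul_eq {a b n : ℤ} {x y : ℚ}
    (h : (twistCurve a b n).Nonsingular x y) (hy : y ≠ 0) :
    ∃ x' y' h', 2 • Point.some x y h = Point.some x' y' h' ∧
      4 * y ^ 2 * x' = (x ^ 2 + a ^ 2 * b ^ 2 * n ^ 2) ^ 2 := by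
  have hne : y ≠ (twistCurve a b n).negY x y := by
    rw [twistCurve_negY]
    intro h
    exact hy (by linarith)
  rw [two_nsmul, Point.add_self_of_Y_ne hne]
  refine ⟨_, _, _, rfl, ?_⟩
  have heq := twistCurve_equation.mp h.1
  rw [slope_of_Y_ne rfl hne, twistCurve_negY]
  simp only [addX, twistCurve]
  field_simp
  ring_nf
  have h4 : y ^ 4 = (y ^ 2) ^ 2 := by ring
  grind

/-- The function `n / x`, which vanishes at the point at infinity; it takes the junk value `0` at
the affine point `(0, 0)`. -/
def twistInvX (a b n : ℤ) : (twistCurve a b n).Point → ℚ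
  | .zero => 0
  | .some x _ _ => n / x

@[simp]
theorem twistInvX_zero (a b n : ℤ) : twistInvX a b n 0 = 0 := rfl

@[simp]
theorem twistInvX_neg {a b n : ℤ} (P : (twistCurve a b n).Point) :
    twistInvX a b n (-P) = twistInvX a b n P := by
  rcases P with _ | ⟨x, y, h⟩ <;> rfl

open WeierstrassCurve.Affine in
theorem twistInvX_two_nsmul {a b n : ℤ} (hn : n ≠ 0) {P : (twistCurve a b n).Point}
    (hP : twistInvX a b n P = 0 → P = 0) (hP2 : twistInvX a b n (2 • P) = 0 → 2 • P = 0) :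
    twistInvX a b n (2 • P) * (1 + a ^ 2 * b ^ 2 * twistInvX a b n P ^ 2) ^ 2 =
      4 * twistInvX a b n P * (1 - a ^ 2 * twistInvX a b n P) *
        (1 + b ^ 2 * twistInvX a b n P) := by
  have hn' : (n : ℚ) ≠ 0 := by exact_mod_cast hn
  rcases P with _ | ⟨x, y, h⟩
  · rw [← Point.zero_def]
    simp
  have hx : x ≠ 0 := by
    rintro rfl
    exact Point.some_ne_zero h (hP (by simp [twistInvX]))
  have heq := twistCurve_equation.mp h.1
  by_cases hy : y = 0
  · rw [(twistCurve_two_nsmul_eq_zero_iff h).mpr hy]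
    subst hy
    have hroot : x * ((x - a ^ 2 * n) * (x + b ^ 2 * n)) = 0 := by linear_combination -heq
    have hfac : 4 * (n / x) * (1 - a ^ 2 * (n / x)) * (1 + b ^ 2 * (n / x)) =
        4 * n / x ^ 4 * (x * ((x - a ^ 2 * n) * (x + b ^ 2 * n))) := by
      field_simp
    simp only [twistInvX]
    rw [hfac, hroot, mul_zero, zero_mul]
  · obtain ⟨x', y', h', h2, hx'⟩ := twistCurve_exists_two_nsmul_eq h hy
    rw [h2] at hP2 ⊢
    have hx0 : x' ≠ 0 := by
      rintro rfl
      exact Point.some_ne_zero h' (hP2 (by simp [twistInvX]))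
    simp only [twistInvX]
    field_simp
    rw [heq] at hx'
    linear_combination -hx'

open WeierstrassCurve.Affine in
theorem twistInvX_add_add_twistInvX_sub {a b n : ℤ} (hn : n ≠ 0)
    {H : AddSubgroup (twistCurve a b n).Point} (hH : ∀ P ∈ H, twistInvX a b n P = 0 → P = 0)
    {P Q : (twistCurve a b n).Point} (hP : P ∈ H) (hQ : Q ∈ H) :
    (twistInvX a b n (P + Q) + twistInvX a b n (P - Q)) *
        (1 + a ^ 2 * b ^ 2 * twistInvX a b n P * twistInvX a b n Q) ^ 2 =
      2 * ((twistInvX a b n P + twistInvX a b n Q) *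
          (1 - a ^ 2 * b ^ 2 * twistInvX a b n P * twistInvX a b n Q) +
        2 * (b ^ 2 - a ^ 2) * twistInvX a b n P * twistInvX a b n Q) := by
  have hn' : (n : ℚ) ≠ 0 := by exact_mod_cast hn
  have hadd := hH _ (H.add_mem hP hQ)
  have hsub := hH _ (H.sub_mem hP hQ)
  by_cases hP0 : P = 0
  · subst hP0
    simp
    ring
  by_cases hQ0 : Q = 0
  · subst hQ0
    simp
    ring
  by_cases hPQ : P = Q
  · subst hPQ
    have := twistInvX_two_nsmul hn (hH _ hP) (hH _ (H.nsmul_mem hP 2))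
    rw [two_nsmul] at this
    rw [sub_self, twistInvX_zero]
    linear_combination this
  by_cases hPQ' : P = -Q
  · subst hPQ'
    have := twistInvX_two_nsmul hn (hH _ hQ) (hH _ (H.nsmul_mem hQ 2))
    rw [two_nsmul] at this
    rw [neg_add_cancel, twistInvX_zero, ← neg_add', twistInvX_neg, twistInvX_neg]
    linear_combination this
  rcases P with _ | ⟨x₁, y₁, h₁⟩
  · exact absurd rfl hP0
  rcases Q with _ | ⟨x₂, y₂, h₂⟩
  · exact absurd rfl hQ0
  have hx : x₁ ≠ x₂ := fun hx ↦ (Point.X_eq_iff.mp hx).elim hPQ hPQ'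
  have hx₁ : x₁ ≠ 0 := by
    rintro rfl
    exact hP0 (hH _ hP (by simp [twistInvX]))
  have hx₂ : x₂ ≠ 0 := by
    rintro rfl
    exact hQ0 (hH _ hQ (by simp [twistInvX]))
  rw [Point.add_of_X_ne hx] at hadd ⊢
  rw [sub_eq_add_neg, Point.neg_some, Point.add_of_X_ne hx] at hsub ⊢
  have hd : x₁ - x₂ ≠ 0 := sub_ne_zero.mpr hx
  have e₁ := twistCurve_equation.mp h₁.1
  have e₂ := twistCurve_equation.mp h₂.1
  have hxadd : ∀ x y h, (twistInvX a b n (.some x y h) = 0 → Point.some x y h = 0) → x ≠ 0 := by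
    rintro x y h h0 rfl
    exact Point.some_ne_zero h (h0 (by simp [twistInvX]))
  replace hadd := hxadd _ _ _ hadd
  replace hsub := hxadd _ _ _ hsub
  simp only [twistInvX]
  rw [slope_of_X_ne hx] at hadd ⊢
  rw [slope_of_X_ne hx, twistCurve_negY] at hsub ⊢
  generalize hs : (twistCurve a b n).addX x₁ x₂ ((y₁ - y₂) / (x₁ - x₂)) = s at hadd ⊢
  generalize ht : (twistCurve a b n).addX x₁ x₂ ((y₁ - -y₂) / (x₁ - x₂)) = t at hsub ⊢
  simp only [addX, twistCurve] at hs ht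
  field_simp at hs ht
  have hprod : s * t * (x₁ - x₂) ^ 2 = (x₁ * x₂ + a ^ 2 * b ^ 2 * n ^ 2) ^ 2 := by
    apply mul_right_cancel₀ (pow_ne_zero 2 hd)
    have hst : s * t * (x₁ - x₂) ^ 2 * (x₁ - x₂) ^ 2 =
        (y₁ ^ 2 - y₂ ^ 2) ^ 2 -
          2 * ((n * (b ^ 2 - a ^ 2) + x₁ + x₂) * (x₁ - x₂) ^ 2) * (y₁ ^ 2 + y₂ ^ 2) +
          ((n * (b ^ 2 - a ^ 2) + x₁ + x₂) * (x₁ - x₂) ^ 2) ^ 2 := by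
      rw [show s * t * (x₁ - x₂) ^ 2 * (x₁ - x₂) ^ 2 =
        ((x₁ - x₂) ^ 2 * s) * ((x₁ - x₂) ^ 2 * t) by ring, ← hs, ← ht]
      ring
    rw [hst, e₁, e₂]
    ring
  have hsum : (s + t) * (x₁ - x₂) ^ 2 =
      2 * ((x₁ + x₂) * (x₁ * x₂ - a ^ 2 * b ^ 2 * n ^ 2) +
        2 * (b ^ 2 * n - a ^ 2 * n) * x₁ * x₂) := by
    linear_combination -hs - ht + 2 * e₁ + 2 * e₂
  field_simp
  linear_combination (-(s + t)) * hprod + s * t * hsum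

open WeierstrassCurve.Affine in
theorem eq_zero_of_twistInvX_eq_zero {a b n : ℤ} (hn : n ≠ 0) {P : (twistCurve a b n).Point}
    (hodd : Odd (addOrderOf P)) (hP : twistInvX a b n P = 0) : P = 0 := by
  rcases P with _ | ⟨x, y, h⟩
  · rfl
  have hn' : (n : ℚ) ≠ 0 := by exact_mod_cast hn
  have hx : x = 0 := by simpa [twistInvX, hn'] using hP
  subst hx
  have hy : y = 0 := by simpa using twistCurve_equation.mp h.1
  have hdvd := addOrderOf_dvd_of_nsmul_eq_zero ((twistCurve_two_nsmul_eq_zero_iff h).mpr hy)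
  have hone := Nat.Coprime.eq_one_of_dvd hodd.coprime_two_right hdvd
  exact AddMonoid.addOrderOf_eq_one_iff.mp hone

theorem PadicInt.isUnit_of_toZMod_ne_zero {p : ℕ} [Fact p.Prime] {x : ℤ_[p]}
    (hx : PadicInt.toZMod x ≠ 0) : IsUnit x := by
  contrapose! hx
  rwa [← RingHom.mem_ker, PadicInt.ker_toZMod, IsLocalRing.mem_maximalIdeal, mem_nonunits_iff]

theorem exists_eq_three_mul_of_mul_sq_eq {s : ℚ_[3]} {d m : ℤ_[3]} (h : s * d ^ 2 = m)
    (hd : PadicInt.toZMod d ≠ 0) (hm : PadicInt.toZMod m = 0) : ∃ v : ℤ_[3], s = 3 * v := by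
  obtain ⟨e, he⟩ := (PadicInt.isUnit_of_toZMod_ne_zero hd).exists_right_inv
  rw [← RingHom.mem_ker, PadicInt.ker_toZMod, PadicInt.maximalIdeal_eq_span_p,
    Ideal.mem_span_singleton] at hm
  obtain ⟨k, rfl⟩ := hm
  refine ⟨k * e ^ 2, ?_⟩
  have he' : (d : ℚ_[3]) * e = 1 := by rw [← PadicInt.coe_mul, he, PadicInt.coe_one]
  rw [PadicInt.coe_mul, PadicInt.coe_natCast] at h
  push_cast at h ⊢
  calc s = s * d ^ 2 * e ^ 2 := by rw [mul_assoc, ← mul_pow, he', one_pow, mul_one]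
    _ = _ := by rw [h]; ring

theorem exists_eq_three_mul_of_duplication {a b : ℤ} (ha : (a : ZMod 3) ^ 2 = 1)
    (hb : (b : ZMod 3) ^ 2 = 1) {s u : ℚ_[3]}
    (h : s * (1 + a ^ 2 * b ^ 2 * u ^ 2) ^ 2 = 4 * u * (1 - a ^ 2 * u) * (1 + b ^ 2 * u)) :
    ∃ v : ℤ_[3], s = 3 * v := by
  have hden : ∀ z : ZMod 3, 1 + z ^ 2 ≠ 0 := by decide
  have hden' : ∀ z : ZMod 3, z ^ 2 + 1 ≠ 0 := by decide
  have hnum : ∀ z : ZMod 3, 4 * z * (1 - z) * (1 + z) = 0 := by decide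
  have hnum' : ∀ z : ZMod 3, 4 * z * (z - 1) * (z + 1) = 0 := by decide
  have hcoe : ((4 : ℤ_[3]) : ℚ_[3]) = 4 := rfl
  have hmap : PadicInt.toZMod (4 : ℤ_[3]) = 4 := map_ofNat PadicInt.toZMod 4
  rcases le_total ‖u‖ 1 with hu | hu
  · obtain ⟨u, rfl⟩ : ∃ u' : ℤ_[3], u' = u := ⟨⟨u, hu⟩, rfl⟩
    refine exists_eq_three_mul_of_mul_sq_eq (d := 1 + a ^ 2 * b ^ 2 * u ^ 2)
      (m := 4 * u * (1 - a ^ 2 * u) * (1 + b ^ 2 * u)) (by push_cast [hcoe]; exact h) ?_ ?_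
    · simpa [ha, hb] using hden (PadicInt.toZMod u)
    · simpa [ha, hb, hmap] using hnum (PadicInt.toZMod u)
  · have hu0 : u ≠ 0 := norm_ne_zero_iff.mp (by linarith)
    obtain ⟨w, rfl⟩ : ∃ w, u = w⁻¹ := ⟨u⁻¹, (inv_inv u).symm⟩
    have hw0 : w ≠ 0 := by simpa using hu0
    have hw : ‖w‖ ≤ 1 := by
      rw [norm_inv] at hu
      exact (one_le_inv₀ (norm_pos_iff.mpr hw0)).mp hu
    obtain ⟨w, rfl⟩ : ∃ w' : ℤ_[3], w' = w := ⟨⟨w, hw⟩, rfl⟩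
    field_simp at h
    refine exists_eq_three_mul_of_mul_sq_eq (d := w ^ 2 + a ^ 2 * b ^ 2)
      (m := 4 * w * (w - a ^ 2) * (w + b ^ 2)) (by push_cast [hcoe]; linear_combination h) ?_ ?_
    · simpa [ha, hb] using hden' (PadicInt.toZMod w)
    · simpa [ha, hb, hmap] using hnum' (PadicInt.toZMod w)

theorem exists_twistInvX_nsmul_eq {a b n : ℤ} (hn : n ≠ 0) (hab : 3 ∣ b ^ 2 - a ^ 2)
    {Q : (twistCurve a b n).Point} (hodd : Odd (addOrderOf Q)) {v : ℤ_[3]}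
    (hv : (twistInvX a b n Q : ℚ_[3]) = 3 * v) (i : ℕ) :
    ∃ w : ℤ_[3], (twistInvX a b n (i • Q) : ℚ_[3]) = 3 * v * (i ^ 2 + 9 * w) := by
  induction i using Nat.twoStepInduction with
  | zero => exact ⟨0, by simp⟩
  | one => exact ⟨0, by simp [hv]⟩
  | more i h₀ h₁ =>
    obtain ⟨w₀, h₀⟩ := h₀
    obtain ⟨w₁, h₁⟩ := h₁
    obtain ⟨e, he⟩ := hab
    have hH : ∀ P ∈ AddSubgroup.zmultiples Q, twistInvX a b n P = 0 → P = 0 := fun P hP ↦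
      eq_zero_of_twistInvX_eq_zero hn (hodd.of_dvd_nat (addOrderOf_dvd_of_mem_zmultiples hP))
    have key := twistInvX_add_add_twistInvX_sub hn hH
      (AddSubgroup.nsmul_mem_zmultiples Q (i + 1)) (AddSubgroup.mem_zmultiples Q)
    rw [← succ_nsmul, succ_nsmul Q i, add_sub_cancel_right, ← succ_nsmul] at key
    replace key := congrArg (Rat.cast : ℚ → ℚ_[3]) key
    have he' : (b : ℚ_[3]) ^ 2 - a ^ 2 = 3 * e := by exact_mod_cast he
    push_cast at key h₁
    rw [h₀, h₁, hv, he'] at key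
    have h2 : ((2 : ℤ_[3]) : ℚ_[3]) = 2 := rfl
    have h9 : ((9 : ℤ_[3]) : ℚ_[3]) = 9 := rfl
    have h18 : ((18 : ℤ_[3]) : ℚ_[3]) = 18 := rfl
    set α : ℤ_[3] := (i + 1) ^ 2 + 9 * w₁ with hα
    have hα' : (α : ℚ_[3]) = (i + 1) ^ 2 + 9 * w₁ := by rw [hα]; push_cast [h9]; ring
    rw [← hα'] at key
    set z : ℤ_[3] := a ^ 2 * b ^ 2 * v ^ 2 * α with hz
    have hz' : (z : ℚ_[3]) = a ^ 2 * b ^ 2 * v ^ 2 * α := by rw [hz]; push_cast; ring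
    have hunit : IsUnit ((1 + 9 * z) ^ 2) := by
      refine (PadicInt.isUnit_of_toZMod_ne_zero ?_).pow 2
      have h9 : PadicInt.toZMod (9 : ℤ_[3]) = 0 := map_ofNat PadicInt.toZMod 9
      simp [h9]
    obtain ⟨d, hd⟩ := hunit.exists_right_inv
    have hd' : (1 + 9 * (z : ℚ_[3])) ^ 2 * d = 1 := by
      simpa [h9] using congrArg ((↑) : ℤ_[3] → ℚ_[3]) hd
    refine ⟨2 * w₁ - w₀ + 2 * (-(α + 1) * z + 2 * e * v * α) -
      2 * d * (2 * z + 9 * z ^ 2) * ((α + 1) * (1 - 9 * z) + 18 * e * v * α), ?_⟩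
    push_cast [h2, h9, h18]
    set U : ℚ_[3] := ↑(twistInvX a b n ((i + 1 + 1) • Q))
    have key' : (U + 3 * v * (i ^ 2 + 9 * w₀)) * (1 + 9 * z) ^ 2 =
        6 * v * ((α + 1) * (1 - 9 * z) + 18 * e * v * α) := by
      rw [hz']
      linear_combination key
    linear_combination d * key' - (U + 3 * v * (i ^ 2 + 9 * w₀)) * hd' +
      6 * v * ((α + 1) * (1 - 9 * z) + 18 * e * v * α) * hd' + 6 * v * hα'

theorem eq_zero_of_prime_nsmul_eq_zero {a b n : ℤ} (hn : n ≠ 0) (ha : (a : ZMod 3) ^ 2 = 1)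
    (hb : (b : ZMod 3) ^ 2 = 1) {p : ℕ} (hp : p.Prime) (hp2 : p ≠ 2)
    {P : (twistCurve a b n).Point} (hP : p • P = 0) : P = 0 := by
  have hpodd := hp.odd_of_ne_two hp2
  have hodd : Odd (addOrderOf P) := hpodd.of_dvd_nat (addOrderOf_dvd_of_nsmul_eq_zero hP)
  have hQ : p • (2 • P) = 0 := by rw [nsmul_left_comm, hP, nsmul_zero]
  have hQodd : Odd (addOrderOf (2 • P)) :=
    hpodd.of_dvd_nat (addOrderOf_dvd_of_nsmul_eq_zero hQ)
  have hab : 3 ∣ b ^ 2 - a ^ 2 := by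
    refine (ZMod.intCast_zmod_eq_zero_iff_dvd _ 3).mp ?_
    simp [ha, hb]
  have hdup := congrArg (Rat.cast : ℚ → ℚ_[3]) (twistInvX_two_nsmul hn
    (eq_zero_of_twistInvX_eq_zero hn hodd) (eq_zero_of_twistInvX_eq_zero hn hQodd))
  push_cast at hdup
  obtain ⟨v, hv⟩ := exists_eq_three_mul_of_duplication ha hb hdup
  obtain ⟨j, hj⟩ := hpodd
  have hdouble : 2 • P = 0 := by
    apply eq_zero_of_twistInvX_eq_zero hn hQodd
    suffices hv0 : v = 0 by
      rw [hv0] at hv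
      simpa using hv
    by_contra hv0
    obtain ⟨w₀, h₀⟩ := exists_twistInvX_nsmul_eq hn hab hQodd hv j
    obtain ⟨w₁, h₁⟩ := exists_twistInvX_nsmul_eq hn hab hQodd hv (j + 1)
    have hneg : (j + 1) • (2 • P) = -(j • (2 • P) : (twistCurve a b n).Point) := by
      rw [← add_eq_zero_iff_eq_neg, ← add_nsmul, show j + 1 + j = p by omega]
      exact hQ
    rw [hneg, twistInvX_neg, h₀] at h₁
    have hv0' : (3 : ℚ_[3]) * v ≠ 0 :=
      mul_ne_zero (by norm_num) (PadicInt.coe_ne_zero.mpr hv0)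
    replace h₁ := mul_left_cancel₀ hv0' h₁
    have h9 : ((p : ℤ) : ℤ_[3]) = 3 ^ 2 * (w₀ - w₁) := by
      apply PadicInt.ext
      have hcoe2 : ((2 : ℤ_[3]) : ℚ_[3]) = 2 := rfl
      have hcoe3 : ((3 : ℤ_[3]) : ℚ_[3]) = 3 := rfl
      rw [hj]
      push_cast [hcoe2, hcoe3] at h₁ ⊢
      linear_combination -h₁
    have hdvd := (PadicInt.pow_p_dvd_int_iff (p := 3) 2 p).mp ⟨_, by exact_mod_cast h9⟩
    have hdvd' : 3 * 3 ∣ p := by exact_mod_cast hdvd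
    have h3 : p = 3 := ((Nat.prime_dvd_prime_iff_eq Nat.prime_three hp).mp
      (dvd_of_mul_left_dvd hdvd')).symm
    subst h3
    omega
  rw [hj, add_nsmul, mul_nsmul, hdouble, nsmul_zero, one_nsmul, zero_add] at hP
  exact hP

open WeierstrassCurve.Affine in
theorem two_nsmul_eq_zero_of_four_nsmul_eq_zero {a b c n : ℤ} (ha : a ≠ 0) (hb : b ≠ 0)
    (hc : c ≠ 0) (hn : n ≠ 0) (habc : a ^ 2 + b ^ 2 = 2 * c ^ 2)
    {P : (twistCurve a b n).Point} (hP : 4 • P = 0) : 2 • P = 0 := by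
  rcases P with _ | ⟨x, y, h⟩
  · exact nsmul_zero 2
  by_contra h2
  have hy : y ≠ 0 := fun hy ↦ h2 ((twistCurve_two_nsmul_eq_zero_iff h).mpr hy)
  obtain ⟨x', y', h', hx', heq⟩ := twistCurve_exists_two_nsmul_eq h hy
  have hy' : y' = 0 := by
    rw [← twistCurve_two_nsmul_eq_zero_iff h', ← hx', ← mul_nsmul]
    exact hP
  subst hy'
  have hE := twistCurve_equation.mp h.1
  have hE' := twistCurve_equation.mp h'.1
  have habc' : (a : ℚ) ^ 2 + b ^ 2 = 2 * c ^ 2 := by exact_mod_cast habc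
  have ha' : (a : ℚ) ≠ 0 := by exact_mod_cast ha
  have hb' : (b : ℚ) ≠ 0 := by exact_mod_cast hb
  have hc' : (c : ℚ) ≠ 0 := by exact_mod_cast hc
  have hn' : (n : ℚ) ≠ 0 := by exact_mod_cast hn
  have hsqrt : ∀ r s : ℚ, s ≠ 0 → r ^ 2 ≠ 2 * s ^ 2 := by
    intro r s hs hrs
    have : IsSquare (2 : ℚ) := ⟨r / s, by field_simp; linear_combination -hrs⟩
    norm_num at this
  have hroots : x' * ((x' - a ^ 2 * n) * (x' + b ^ 2 * n)) = 0 := by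
    linear_combination -hE'
  rcases mul_eq_zero.mp hroots with h0 | h0
  · rw [h0, mul_zero, eq_comm, sq_eq_zero_iff] at heq
    have : 0 < (a : ℚ) ^ 2 * b ^ 2 * n ^ 2 := by positivity
    nlinarith [sq_nonneg x]
  rcases mul_eq_zero.mp h0 with h0 | h0
  · refine hsqrt (x - a ^ 2 * n) (a * c * n) (by positivity) ?_
    rw [← sub_eq_zero, ← sq_eq_zero_iff]
    rw [hE, sub_eq_zero.mp h0] at heq
    have h4 : (x ^ 2 - 2 * a ^ 2 * n * x - a ^ 2 * b ^ 2 * n ^ 2) ^ 2 = 0 := by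
      linear_combination -heq
    rw [← h4]
    congr 1
    linear_combination a ^ 2 * n ^ 2 * habc'
  · refine hsqrt (x + b ^ 2 * n) (b * c * n) (by positivity) ?_
    rw [← sub_eq_zero, ← sq_eq_zero_iff]
    rw [hE, eq_neg_of_add_eq_zero_left h0] at heq
    have h4 : (x ^ 2 + 2 * b ^ 2 * n * x - a ^ 2 * b ^ 2 * n ^ 2) ^ 2 = 0 := by
      linear_combination -heq
    rw [← h4]
    congr 1
    linear_combination b ^ 2 * n ^ 2 * habc'

theorem two_nsmul_eq_zero_of_isOfFinAddOrder {a b c n : ℤ} (ha : a ≠ 0) (hb : b ≠ 0)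
    (hc : c ≠ 0) (hn : n ≠ 0) (habc : a ^ 2 + b ^ 2 = 2 * c ^ 2) (ha3 : (a : ZMod 3) ^ 2 = 1)
    (hb3 : (b : ZMod 3) ^ 2 = 1) {P : (twistCurve a b n).Point} (hP : IsOfFinAddOrder P) :
    2 • P = 0 := by
  have hpos := hP.addOrderOf_pos
  rcases Nat.eq_two_pow_or_exists_odd_prime_and_dvd (addOrderOf P) with
    ⟨k, hk⟩ | ⟨p, hp, ⟨m, hm⟩, hpo⟩
  · have key : ∀ k : ℕ, 2 ^ k • P = 0 → 2 • P = 0 := by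
      intro k
      induction k with
      | zero => intro h; rw [(one_nsmul P).symm.trans h, nsmul_zero]
      | succ k ih =>
        intro h
        cases k with
        | zero => simpa using h
        | succ k =>
          apply ih
          have h4 : 4 • (2 ^ k • P) = 0 := by
            rw [← mul_nsmul, ← h]
            congr 1
            ring
          have := two_nsmul_eq_zero_of_four_nsmul_eq_zero ha hb hc hn habc h4
          rwa [← mul_nsmul, ← pow_succ] at this
    exact key k (hk ▸ addOrderOf_nsmul_eq_zero P)
  · have hmP : m • P = 0 := by
      refine eq_zero_of_prime_nsmul_eq_zero hn ha3 hb3 hp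
        (by rintro rfl; exact absurd hpo (by decide)) ?_
      rw [← mul_nsmul, mul_comm, ← hm, addOrderOf_nsmul_eq_zero]
    have hle := Nat.le_of_dvd (Nat.pos_of_ne_zero (by rintro rfl; simp [hm] at hpos))
      (addOrderOf_dvd_of_nsmul_eq_zero hmP)
    have := hp.two_le
    nlinarith

theorem sq_eq_one_zmod_three {a b c : ℤ} (hprim : Int.gcd a (Int.gcd b c) = 1)
    (habc : a ^ 2 + b ^ 2 = 2 * c ^ 2) : (a : ZMod 3) ^ 2 = 1 ∧ (b : ZMod 3) ^ 2 = 1 := by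
  have hz : ∀ x y z : ZMod 3, x ^ 2 + y ^ 2 = 2 * z ^ 2 →
      (x ^ 2 = 1 ∧ y ^ 2 = 1) ∨ (x = 0 ∧ y = 0 ∧ z = 0) := by decide
  refine (hz a b c (by exact_mod_cast congrArg (Int.cast : ℤ → ZMod 3) habc)).resolve_right ?_
  simp only [ZMod.intCast_zmod_eq_zero_iff_dvd]
  rintro ⟨ha, hb, hc⟩
  have := Int.dvd_coe_gcd ha (Int.dvd_coe_gcd hb hc)
  rw [hprim] at this
  norm_num at this

open WeierstrassCurve.Affine in
theorem natCard_torsion_twistCurve {a b n : ℤ} (ha : a ≠ 0) (hb : b ≠ 0) (hn : n ≠ 0)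
    (htors : ∀ P : (twistCurve a b n).Point, IsOfFinAddOrder P → 2 • P = 0) :
    Nat.card (AddCommGroup.torsion (twistCurve a b n).Point) = 4 := by
  have ha' : (a : ℚ) ≠ 0 := by exact_mod_cast ha
  have hb' : (b : ℚ) ≠ 0 := by exact_mod_cast hb
  have hn' : (n : ℚ) ≠ 0 := by exact_mod_cast hn
  have hab : (a : ℚ) ^ 2 + b ^ 2 ≠ 0 := by positivity
  have hns : ∀ x : ℚ, x = 0 ∨ x = a ^ 2 * n ∨ x = -(b ^ 2 * n) →
      (twistCurve a b n).Nonsingular x 0 := by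
    intro x hx
    rw [nonsingular_iff, twistCurve_equation]
    rcases hx with rfl | rfl | rfl
    · refine ⟨by ring, .inl ?_⟩
      simp [twistCurve, ha', hb', hn']
    · refine ⟨by ring, .inl ?_⟩
      simp only [twistCurve]
      intro h
      have : (a : ℚ) ^ 2 * n ^ 2 * (a ^ 2 + b ^ 2) = 0 := by linear_combination -h
      simp [ha', hn', hab] at this
    · refine ⟨by ring, .inl ?_⟩
      simp only [twistCurve]
      intro h
      have : (b : ℚ) ^ 2 * n ^ 2 * (a ^ 2 + b ^ 2) = 0 := by linear_combination -h
      simp [hb', hn', hab] at this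
  set T : Set (twistCurve a b n).Point := {0, .some 0 0 (hns _ (.inl rfl)),
    .some (a ^ 2 * n) 0 (hns _ (.inr (.inl rfl))), .some (-(b ^ 2 * n)) 0 (hns _ (.inr (.inr rfl)))}
    with hT
  have hne : (a : ℚ) ^ 2 * n ≠ -(b ^ 2 * n) := by
    intro h
    have : (n : ℚ) * (a ^ 2 + b ^ 2) = 0 := by linear_combination h
    simp [hn', hab] at this
  have hcard : T.ncard = 4 := by
    rw [hT, Set.ncard_insert_of_notMem, Set.ncard_insert_of_notMem, Set.ncard_pair]
    · simpa using hne
    · simp [ha', hb', hn', eq_comm]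
    · simp [eq_comm (a := (0 : (twistCurve a b n).Point))]
  rw [← hcard, ← Nat.card_coe_set_eq]
  suffices h : (AddCommGroup.torsion (twistCurve a b n).Point : Set _) = T by
    rw [← h]
    rfl
  ext P
  rw [SetLike.mem_coe]
  change IsOfFinAddOrder P ↔ _
  constructor
  · intro hP
    have h2 := htors P hP
    rcases P with _ | ⟨x, y, h⟩
    · exact .inl rfl
    have hy := (twistCurve_two_nsmul_eq_zero_iff h).mp h2
    subst hy
    have heq := twistCurve_equation.mp h.1
    have hroots : x * ((x - a ^ 2 * n) * (x + b ^ 2 * n)) = 0 := by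
      linear_combination -heq
    simp only [mul_eq_zero, sub_eq_zero, add_eq_zero_iff_eq_neg] at hroots
    rcases hroots with rfl | rfl | rfl <;> simp [hT]
  · rintro (rfl | rfl | rfl | rfl)
    · exact IsOfFinAddOrder.zero
    all_goals
      exact isOfFinAddOrder_iff_nsmul_eq_zero.mpr
        ⟨2, two_pos, (twistCurve_two_nsmul_eq_zero_iff _).mpr rfl⟩

theorem stmt5 (a b c n : ℤ) (ha : 0 < a) (hb : 0 < b) (hc : 0 < c)
    (hprim : Int.gcd a (Int.gcd b c) = 1) (habc : a ^ 2 + b ^ 2 = 2 * c ^ 2)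
    (hn : Squarefree n) :
    Nonempty ((AddCommGroup.torsion (twistCurve a b n).Point) ≃+ (ZMod 2 × ZMod 2)) := by
  obtain ⟨ha3, hb3⟩ := sq_eq_one_zmod_three hprim habc
  have htors : ∀ P : (twistCurve a b n).Point, IsOfFinAddOrder P → 2 • P = 0 := fun P hP ↦
    two_nsmul_eq_zero_of_isOfFinAddOrder ha.ne' hb.ne' hc.ne' hn.ne_zero habc ha3 hb3 hP
  have hcard := natCard_torsion_twistCurve ha.ne' hb.ne' hn.ne_zero htors
  have hexp : AddMonoid.exponent (AddCommGroup.torsion (twistCurve a b n).Point) ∣ 2 :=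
    AddMonoid.exponent_dvd_of_forall_nsmul_eq_zero fun P ↦ Subtype.ext (htors P P.2)
  have : IsAddKleinFour (AddCommGroup.torsion (twistCurve a b n).Point) := by
    refine ⟨hcard, ((Nat.dvd_prime Nat.prime_two).mp hexp).resolve_left fun h1 ↦ ?_⟩
    have := AddMonoid.exp_eq_one_iff.mp h1
    rw [Nat.card_of_subsingleton 0] at hcard
    omega
  exact IsAddKleinFour.nonempty_addEquiv
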